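/- Let p ≠ q be real numbers with min(p,q) ≤ 0 ≤ max(p,q) < 1. Then for every real C < ((1−q)/(1−p))^{1/(p−q)} there exists a Lebesgue measurable integrable function f : (0,∞) → (0,∞) with 0 < ∫₀^∞ f < ∞, such that ∫₀^t f(s)^p ds and ∫₀^t f(s)^q ds are finite for every t > 0 and ∫₀^∞ (∫₀^t f(s)^p ds / ∫₀^t f(s)^q ds)^{1/(p−q)} dt > C ∫₀^∞ f(t) dt. -/

import Mathlib

open MeasureTheory Set Real

lemma integrableOn_Ioo_rpow_neg {d : ℝ} (hd : d < 1) (t : ℝ) :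
    IntegrableOn (fun s : ℝ => s ^ (-d)) (Ioo 0 t) := by
  rcases le_or_gt t 0 with ht | ht
  · simp [Ioo_eq_empty_of_le ht]
  · exact ((intervalIntegrable_iff_integrableOn_Ioc_of_le ht.le).1
      (intervalIntegral.intervalIntegrable_rpow' (by linarith))).mono_set Ioo_subset_Ioc_self

lemma integral_Ioo_rpow_neg {d t : ℝ} (hd : d < 1) (ht : 0 < t) :
    ∫ s in Ioo 0 t, s ^ (-d) = t ^ (1 - d) / (1 - d) := by
  rw [← integral_Ioc_eq_integral_Ioo, ← intervalIntegral.integral_of_le ht.le,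
    integral_rpow (Or.inl (by linarith)), zero_rpow (by linarith)]
  ring_nf

/-- The function equal to `s ^ (-a)` for `s ≤ 1` and to `s ^ (-b)` for `s > 1`. -/
noncomputable def piecewisePower (a b s : ℝ) : ℝ := if s ≤ 1 then s ^ (-a) else s ^ (-b)

namespace piecewisePower

variable {a b p q r s t : ℝ}

lemma of_le_one (hs : s ≤ 1) : piecewisePower a b s = s ^ (-a) := if_pos hs

lemma of_one_lt (hs : 1 < s) : piecewisePower a b s = s ^ (-b) := if_neg hs.not_ge

lemma measurable : Measurable (piecewisePower a b) :=
  Measurable.ite measurableSet_Iic (measurable_id.pow_const _) (measurable_id.pow_const _)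

lemma pos (hs : 0 < s) : 0 < piecewisePower a b s := by
  unfold piecewisePower
  split_ifs <;> positivity

lemma rpow_of_le_one (hs : 0 < s) (hs1 : s ≤ 1) :
    piecewisePower a b s ^ r = s ^ (-(a * r)) := by
  rw [of_le_one hs1, ← rpow_mul hs.le, neg_mul]

lemma rpow_of_one_lt (hs1 : 1 < s) :
    piecewisePower a b s ^ r = s ^ (-(b * r)) := by
  rw [of_one_lt hs1, ← rpow_mul (by linarith), neg_mul]

lemma rpow_le (hab : a ≤ b) (hr : 0 ≤ r) (hs : 0 < s) :
    piecewisePower a b s ^ r ≤ s ^ (-(b * r)) := by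
  rcases le_or_gt s 1 with h | h
  · rw [rpow_of_le_one hs h]
    exact rpow_le_rpow_of_exponent_ge hs h (by nlinarith)
  · rw [rpow_of_one_lt h]

lemma le_rpow (hab : a ≤ b) (hr : r ≤ 0) (hs : 0 < s) :
    s ^ (-(b * r)) ≤ piecewisePower a b s ^ r := by
  rcases le_or_gt s 1 with h | h
  · rw [rpow_of_le_one hs h]
    exact rpow_le_rpow_of_exponent_ge hs h (by nlinarith)
  · rw [rpow_of_one_lt h]

lemma integrableOn_rpow (har : a * r < 1) (hbr : b * r < 1) (t : ℝ) :
    IntegrableOn (fun s => piecewisePower a b s ^ r) (Ioo 0 t) := by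
  refine ((integrableOn_Ioo_rpow_neg har t).add (integrableOn_Ioo_rpow_neg hbr t)).mono'
    (measurable.pow_const r).aestronglyMeasurable ?_
  filter_upwards [ae_restrict_mem measurableSet_Ioo] with s hs
  have hs0 : 0 < s := hs.1
  rw [norm_of_nonneg (rpow_nonneg (pos hs0).le r), Pi.add_apply]
  have h1 := rpow_nonneg hs0.le (-(a * r))
  have h2 := rpow_nonneg hs0.le (-(b * r))
  rcases le_or_gt s 1 with h | h
  · rw [rpow_of_le_one hs0 h]; linarith
  · rw [rpow_of_one_lt h]; linarith

lemma integral_rpow_nonneg : 0 ≤ ∫ s in Ioo 0 t, piecewisePower a b s ^ r :=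
  setIntegral_nonneg measurableSet_Ioo fun _ hs => rpow_nonneg (pos hs.1).le r

lemma integral_rpow_of_le_one (har : a * r < 1) (ht : 0 < t) (ht1 : t ≤ 1) :
    ∫ s in Ioo 0 t, piecewisePower a b s ^ r = t ^ (1 - a * r) / (1 - a * r) := by
  rw [← integral_Ioo_rpow_neg har ht]
  exact setIntegral_congr_fun measurableSet_Ioo fun s hs =>
    rpow_of_le_one hs.1 (hs.2.le.trans ht1)

lemma aemeasurable_integral_rpow (har : a * r < 1) (hbr : b * r < 1) :
    AEMeasurable (fun t => ∫ s in Ioo 0 t, piecewisePower a b s ^ r)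
      (volume.restrict (Ioi 0)) := by
  refine aemeasurable_restrict_of_monotoneOn measurableSet_Ioi fun t _ u _ htu => ?_
  refine setIntegral_mono_set (integrableOn_rpow har hbr u) ?_
    (Ioo_subset_Ioo_right htu).eventuallyLE
  filter_upwards [ae_restrict_mem measurableSet_Ioo] with s hs
  exact rpow_nonneg (pos hs.1).le r

lemma integrableOn_Ioi (ha : a < 1) (hb : 1 < b) :
    IntegrableOn (piecewisePower a b) (Ioi 0) := by
  rw [← Ioc_union_Ioi_eq_Ioi zero_le_one]
  refine IntegrableOn.union ?_ ?_
  · rw [integrableOn_Ioc_iff_integrableOn_Ioo]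
    exact (integrableOn_Ioo_rpow_neg ha 1).congr_fun
      (fun s hs => (of_le_one hs.2.le).symm) measurableSet_Ioo
  · exact (integrableOn_Ioi_rpow_of_lt (by linarith : -b < -1) one_pos).congr_fun
      (fun s hs => (of_one_lt hs).symm) measurableSet_Ioi

lemma integral_Ioi (ha : a < 1) (hb : 1 < b) :
    ∫ s in Ioi 0, piecewisePower a b s = 1 / (1 - a) + 1 / (b - 1) := by
  have hint := integrableOn_Ioi ha hb
  rw [← Ioc_union_Ioi_eq_Ioi zero_le_one] at hint ⊢
  rw [setIntegral_union Ioc_disjoint_Ioi_same measurableSet_Ioi hint.left_of_union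
    hint.right_of_union, integral_Ioc_eq_integral_Ioo]
  congr 1
  · rw [setIntegral_congr_fun measurableSet_Ioo fun s hs => of_le_one hs.2.le,
      integral_Ioo_rpow_neg ha one_pos, one_rpow]
  · rw [setIntegral_congr_fun measurableSet_Ioi fun s hs => of_one_lt hs,
      integral_Ioi_rpow_of_lt (by linarith) one_pos, one_rpow, neg_div, ← div_neg]
    ring_nf

/-- The integral Gini mean of `piecewisePower a b` over `(0, t)`. -/
noncomputable def giniMean (a b p q t : ℝ) : ℝ :=
  ((∫ s in Ioo 0 t, piecewisePower a b s ^ p) /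
    (∫ s in Ioo 0 t, piecewisePower a b s ^ q)) ^ (1 / (p - q))

lemma giniMean_nonneg : 0 ≤ giniMean a b p q t :=
  rpow_nonneg (div_nonneg integral_rpow_nonneg integral_rpow_nonneg) _

lemma div_rpow_one_div_sub {c : ℝ} (hpq : p ≠ q) (hp : c * p < 1) (hq : c * q < 1) (ht : 0 < t) :
    (t ^ (1 - c * p) / (1 - c * p) / (t ^ (1 - c * q) / (1 - c * q))) ^ (1 / (p - q)) =
      ((1 - c * q) / (1 - c * p)) ^ (1 / (p - q)) * t ^ (-c) := by
  have hp' : 0 < 1 - c * p := by linarith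
  have hq' : 0 < 1 - c * q := by linarith
  have hpq' : p - q ≠ 0 := sub_ne_zero.2 hpq
  have key : t ^ (1 - c * p) / (1 - c * p) / (t ^ (1 - c * q) / (1 - c * q)) =
      (1 - c * q) / (1 - c * p) * t ^ (-c * (p - q)) := by
    rw [show -c * (p - q) = (1 - c * p) - (1 - c * q) by ring, rpow_sub ht (1 - c * p)]
    have := rpow_pos_of_pos ht (1 - c * q)
    field_simp
  rw [key, mul_rpow (by positivity) (by positivity), ← rpow_mul ht.le]
  congr 2
  field_simp

lemma giniMean_of_le_one (hpq : p ≠ q) (hp : a * p < 1) (hq : a * q < 1) (ht : 0 < t)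
    (ht1 : t ≤ 1) :
    giniMean a b p q t = ((1 - a * q) / (1 - a * p)) ^ (1 / (p - q)) * t ^ (-a) := by
  rw [giniMean, integral_rpow_of_le_one hp ht ht1, integral_rpow_of_le_one hq ht ht1,
    div_rpow_one_div_sub hpq hp hq ht]

lemma giniMean_le (hpq : p ≠ q) (ha : 0 ≤ a) (hab : a ≤ b) (hp : 0 ≤ p) (hq : q ≤ 0)
    (hbp : b * p < 1) (ht : 0 < t) :
    giniMean a b p q t ≤ ((1 - b * q) / (1 - b * p)) ^ (1 / (p - q)) * t ^ (-b) := by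
  have hap : a * p < 1 := by nlinarith
  have haq : a * q < 1 := by nlinarith
  have hbq : b * q < 1 := by nlinarith
  have hbq' : 0 < 1 - b * q := by linarith
  rw [← div_rpow_one_div_sub hpq hbp hbq ht, giniMean]
  refine rpow_le_rpow (div_nonneg integral_rpow_nonneg integral_rpow_nonneg) ?_
    (one_div_nonneg.2 (by linarith))
  rw [← integral_Ioo_rpow_neg hbp ht]
  refine div_le_div₀ (setIntegral_nonneg measurableSet_Ioo fun s hs => rpow_nonneg hs.1.le _)
    ?_ (by positivity) ?_
  · exact setIntegral_mono_on (integrableOn_rpow hap hbp t) (integrableOn_Ioo_rpow_neg hbp t)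
      measurableSet_Ioo fun s hs => rpow_le hab hp hs.1
  · rw [← integral_Ioo_rpow_neg hbq ht]
    exact setIntegral_mono_on (integrableOn_Ioo_rpow_neg hbq t) (integrableOn_rpow haq hbq t)
      measurableSet_Ioo fun s hs => le_rpow hab hq hs.1

lemma integrableOn_giniMean (hpq : p ≠ q) (ha : 0 ≤ a) (ha1 : a < 1) (hb : 1 < b) (hp : 0 ≤ p)
    (hq : q ≤ 0) (hbp : b * p < 1) : IntegrableOn (giniMean a b p q) (Ioi 0) := by
  have hap : a * p < 1 := by nlinarith
  have haq : a * q < 1 := by nlinarith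
  have hbq : b * q < 1 := by nlinarith
  have hmeas : AEMeasurable (giniMean a b p q) (volume.restrict (Ioi 0)) :=
    ((aemeasurable_integral_rpow hap hbp).div (aemeasurable_integral_rpow haq hbq)).pow_const _
  rw [← Ioc_union_Ioi_eq_Ioi zero_le_one]
  refine IntegrableOn.union ?_ ?_
  · rw [integrableOn_Ioc_iff_integrableOn_Ioo]
    exact IntegrableOn.congr_fun ((integrableOn_Ioo_rpow_neg ha1 1).const_mul _)
      (fun s hs => (giniMean_of_le_one hpq hap haq hs.1 hs.2.le).symm) measurableSet_Ioo
  · refine ((integrableOn_Ioi_rpow_of_lt (by linarith : -b < -1) one_pos).const_mul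
      (((1 - b * q) / (1 - b * p)) ^ (1 / (p - q)))).mono'
      (hmeas.mono_set (Ioi_subset_Ioi zero_le_one)).aestronglyMeasurable ?_
    filter_upwards [ae_restrict_mem measurableSet_Ioi] with s hs
    rw [norm_of_nonneg giniMean_nonneg]
    exact giniMean_le hpq ha (by linarith) hp hq hbp (zero_lt_one.trans hs)

lemma le_integral_giniMean (hpq : p ≠ q) (ha : 0 ≤ a) (ha1 : a < 1) (hb : 1 < b) (hp : 0 ≤ p)
    (hq : q ≤ 0) (hbp : b * p < 1) :
    ((1 - a * q) / (1 - a * p)) ^ (1 / (p - q)) / (1 - a) ≤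
      ∫ t in Ioi 0, giniMean a b p q t := by
  have hap : a * p < 1 := by nlinarith
  have haq : a * q < 1 := by nlinarith
  calc ((1 - a * q) / (1 - a * p)) ^ (1 / (p - q)) / (1 - a)
      = ∫ t in Ioo 0 1, giniMean a b p q t := by
        rw [setIntegral_congr_fun measurableSet_Ioo fun s hs =>
          giniMean_of_le_one hpq hap haq hs.1 hs.2.le, integral_const_mul,
          integral_Ioo_rpow_neg ha1 one_pos, one_rpow, mul_one_div]
    _ ≤ ∫ t in Ioi 0, giniMean a b p q t :=
        setIntegral_mono_set (integrableOn_giniMean hpq ha ha1 hb hp hq hbp)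
          (Filter.Eventually.of_forall fun _ => giniMean_nonneg)
          Ioo_subset_Ioi_self.eventuallyLE

end piecewisePower

open Filter Topology in
lemma exists_mul_lt_gini_power_const {p q : ℝ} (hp : p < 1) (hq : q < 1) {C : ℝ}
    (hC : C < ((1 - q) / (1 - p)) ^ (1 / (p - q))) (k : ℝ) :
    ∃ a, 0 ≤ a ∧ a < 1 ∧
      C * (1 + (1 - a) * k) < ((1 - a * q) / (1 - a * p)) ^ (1 / (p - q)) := by
  have hp' : 1 - 1 * p ≠ 0 := by linarith
  have hpos : (1 - 1 * q) / (1 - 1 * p) ≠ 0 := div_ne_zero (by linarith) hp'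
  have hl : ContinuousAt (fun a : ℝ => C * (1 + (1 - a) * k)) 1 := by fun_prop
  have hdiv : ContinuousAt (fun a : ℝ => (1 - a * q) / (1 - a * p)) 1 :=
    ContinuousAt.div (by fun_prop) (by fun_prop) hp'
  have hr : ContinuousAt (fun a : ℝ => ((1 - a * q) / (1 - a * p)) ^ (1 / (p - q))) 1 :=
    hdiv.rpow_const (Or.inl hpos)
  have hlt : ∀ᶠ a in 𝓝[<] (1 : ℝ),
      C * (1 + (1 - a) * k) < ((1 - a * q) / (1 - a * p)) ^ (1 / (p - q)) :=
    (hl.eventually_lt hr (by simpa using hC)).filter_mono nhdsWithin_le_nhds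
  obtain ⟨a, ha, ha0, ha1⟩ := (hlt.and (Ioo_mem_nhdsLT zero_lt_one)).exists
  exact ⟨a, ha0.le, ha1, ha⟩

lemma integral_hardy_gini_sharp_of_nonpos_of_nonneg {p q : ℝ} (hpq : p ≠ q) (hq : q ≤ 0)
    (hp : 0 ≤ p) (hp1 : p < 1) {C : ℝ} (hC : C < ((1 - q) / (1 - p)) ^ (1 / (p - q))) :
    ∃ f : ℝ → ℝ, Measurable f ∧ IntegrableOn f (Ioi 0) ∧
      (∀ t ∈ Ioi (0 : ℝ), 0 < f t) ∧
      (0 < ∫ t in Ioi (0 : ℝ), f t) ∧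
      (∀ t ∈ Ioi (0 : ℝ), IntegrableOn (fun s => f s ^ p) (Ioo 0 t)) ∧
      (∀ t ∈ Ioi (0 : ℝ), IntegrableOn (fun s => f s ^ q) (Ioo 0 t)) ∧
      C * ∫ t in Ioi (0 : ℝ), f t
        < ∫ t in Ioi (0 : ℝ),
            ((∫ s in Ioo (0 : ℝ) t, f s ^ p) / (∫ s in Ioo (0 : ℝ) t, f s ^ q)) ^
              (1 / (p - q)) := by
  obtain ⟨b, hb, hbp⟩ : ∃ b : ℝ, 1 < b ∧ b * p < 1 := by
    have h : 0 < 1 + p := by linarith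
    refine ⟨2 / (1 + p), by rw [lt_div_iff₀ h]; linarith, ?_⟩
    rw [div_mul_eq_mul_div, div_lt_one h]
    linarith
  obtain ⟨a, ha, ha1, hlt⟩ := exists_mul_lt_gini_power_const hp1 (by linarith) hC (1 / (b - 1))
  have ha' : 0 < 1 - a := by linarith
  have hb' : 0 < b - 1 := by linarith
  have hint := piecewisePower.integral_Ioi ha1 hb
  refine ⟨piecewisePower a b, piecewisePower.measurable, piecewisePower.integrableOn_Ioi ha1 hb,
    fun t ht => piecewisePower.pos ht, by rw [hint]; positivity,
    fun t _ => piecewisePower.integrableOn_rpow (by nlinarith) hbp t,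
    fun t _ => piecewisePower.integrableOn_rpow (by nlinarith) (by nlinarith) t,
    lt_of_lt_of_le ?_ (piecewisePower.le_integral_giniMean hpq ha ha1 hb hp hq hbp)⟩
  rw [hint, lt_div_iff₀ ha']
  refine lt_of_eq_of_lt ?_ hlt
  field_simp

lemma div_rpow_one_div_sub_comm {x y : ℝ} (hx : 0 ≤ x) (hy : 0 ≤ y) (p q : ℝ) :
    (x / y) ^ (1 / (p - q)) = (y / x) ^ (1 / (q - p)) := by
  rw [← inv_div y x, inv_rpow (div_nonneg hy hx), ← rpow_neg (div_nonneg hy hx), ← div_neg,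
    neg_sub]

/-- Sharpness of the constant `((1-q)/(1-p))^(1/(p-q))` in the integral Hardy
inequality for Gini means with `min(p,q) ≤ 0 ≤ max(p,q) < 1` and `p ≠ q`. -/
theorem integral_hardy_gini_sharp (p q : ℝ) (hpq : p ≠ q)
    (hmin : min p q ≤ 0) (hmax0 : 0 ≤ max p q) (hmax1 : max p q < 1)
    (C : ℝ) (hC : C < ((1 - q)/(1 - p)) ^ (1/(p-q))) :
    ∃ f : ℝ → ℝ, Measurable f ∧ IntegrableOn f (Set.Ioi 0) ∧
      (∀ t ∈ Set.Ioi (0:ℝ), 0 < f t) ∧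
      (0 < ∫ t in Set.Ioi (0:ℝ), f t) ∧
      (∀ t ∈ Set.Ioi (0:ℝ), IntegrableOn (fun s => f s ^ p) (Set.Ioo 0 t)) ∧
      (∀ t ∈ Set.Ioi (0:ℝ), IntegrableOn (fun s => f s ^ q) (Set.Ioo 0 t)) ∧
      C * ∫ t in Set.Ioi (0:ℝ), f t
        < ∫ t in Set.Ioi (0:ℝ),
            ((∫ s in Set.Ioo (0:ℝ) t, f s ^ p) / (∫ s in Set.Ioo (0:ℝ) t, f s ^ q)) ^ (1/(p-q)) := by
  rcases lt_or_gt_of_ne hpq with h | h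
  · rw [min_eq_left h.le] at hmin
    rw [max_eq_right h.le] at hmax0 hmax1
    rw [div_rpow_one_div_sub_comm (by linarith) (by linarith)] at hC
    obtain ⟨f, hf, hfi, hpos, hint, hq, hp, hlt⟩ :=
      integral_hardy_gini_sharp_of_nonpos_of_nonneg hpq.symm hmin hmax0 hmax1 hC
    refine ⟨f, hf, hfi, hpos, hint, hp, hq, hlt.trans_eq ?_⟩
    have hnonneg : ∀ r t : ℝ, 0 ≤ ∫ s in Ioo (0 : ℝ) t, f s ^ r := fun r t =>
      setIntegral_nonneg measurableSet_Ioo fun s hs => rpow_nonneg (hpos s hs.1).le r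
    simp_rw [div_rpow_one_div_sub_comm (hnonneg q _) (hnonneg p _) q p]
  · rw [min_eq_right h.le] at hmin
    rw [max_eq_left h.le] at hmax0 hmax1
    exact integral_hardy_gini_sharp_of_nonpos_of_nonneg hpq hmin hmax0 hmax1 hC
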